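/- L² Bernstein–von Mises limit for the Poisson–gamma posterior variance under the prior: For all α, β > 0, the iterated expectation ∫ (∫ |n·(α + S(x))/(n + β)² − θ|² dPoi(θ)^{⊗n}(x)) dGamma(α,β)(θ) converges to 0 as n → ∞. -/

import Mathlib

open MeasureTheory ProbabilityTheory Filter

section Poisson

open scoped Nat NNReal

/-- The Chen–Stein identity `E[N f(N - 1)] = r E[f(N)]` for a Poisson variable `N`. -/
lemma hasSum_poisson_mul_pred {r : ℝ≥0} {f : ℕ → ℝ} {a : ℝ}
    (hf : HasSum (fun n ↦ Real.exp (-r) * r ^ n / n ! * f n) a) :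
    HasSum (fun n : ℕ ↦ Real.exp (-r) * r ^ n / n ! * (n * f (n - 1))) (r * a) := by
  rw [← hasSum_nat_add_iff' 1]
  convert! hf.mul_left (r : ℝ) using 1
  · ext n
    have : (n ! : ℝ) ≠ 0 := by positivity
    rw [Nat.factorial_succ]
    push_cast
    field_simp
    ring
  · simp

lemma hasSum_poisson_mul_natCast (r : ℝ≥0) :
    HasSum (fun n : ℕ ↦ Real.exp (-r) * r ^ n / n ! * (n : ℝ)) r := by
  simpa using hasSum_poisson_mul_pred (f := fun _ ↦ 1) (a := 1)
    (by simpa using hasSum_one_poissonMeasure r)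

lemma hasSum_poisson_mul_natCast_sq (r : ℝ≥0) :
    HasSum (fun n : ℕ ↦ Real.exp (-r) * r ^ n / n ! * (n : ℝ) ^ 2) ((r : ℝ) ^ 2 + r) := by
  convert! (hasSum_poisson_mul_pred (hasSum_poisson_mul_natCast r)).add
    (hasSum_poisson_mul_natCast r) using 1
  · ext n
    cases n with
    | zero => simp
    | succ n => simp only [Nat.add_sub_cancel]; push_cast; ring
  · ring

lemma integral_natCast_poissonMeasure (r : ℝ≥0) : ∫ n, (n : ℝ) ∂poissonMeasure r = r := by
  rw [integral_poissonMeasure]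
  exact (hasSum_poisson_mul_natCast r).tsum_eq

lemma memLp_natCast_poissonMeasure (r : ℝ≥0) :
    MemLp (fun n : ℕ ↦ (n : ℝ)) 2 (poissonMeasure r) := by
  rw [memLp_two_iff_integrable_sq .of_discrete, integrable_poissonMeasure_iff]
  simpa using (hasSum_poisson_mul_natCast_sq r).summable

lemma variance_natCast_poissonMeasure (r : ℝ≥0) :
    Var[fun n : ℕ ↦ (n : ℝ); poissonMeasure r] = r := by
  have h : ∫ n, ((fun n : ℕ ↦ (n : ℝ)) ^ 2) n ∂poissonMeasure r = (r : ℝ) ^ 2 + r := by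
    rw [integral_poissonMeasure]
    exact (hasSum_poisson_mul_natCast_sq r).tsum_eq
  rw [variance_eq_sub (memLp_natCast_poissonMeasure r), h, integral_natCast_poissonMeasure]
  ring

/-- Bias–variance decomposition for an affine function of the sum of a Poisson sample. -/
lemma integral_sq_affine_sum_pi_poissonMeasure (n : ℕ) (r : ℝ≥0) (a c : ℝ) :
    ∫ x : Fin n → ℕ, (c * ∑ i, (x i : ℝ) + a) ^ 2 ∂(Measure.pi fun _ ↦ poissonMeasure r) =
      c ^ 2 * (n * r) + (c * (n * r) + a) ^ 2 := by
  set μ : Measure (Fin n → ℕ) := Measure.pi fun _ ↦ poissonMeasure r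
  have hL (i : Fin n) : MemLp (fun x : Fin n → ℕ ↦ (x i : ℝ)) 2 μ :=
    (memLp_natCast_poissonMeasure r).comp_measurePreserving (measurePreserving_eval _ i)
  have hS : MemLp (fun x : Fin n → ℕ ↦ ∑ i, (x i : ℝ)) 2 μ := memLp_finsetSum _ fun i _ ↦ hL i
  have hES : ∫ x, ∑ i, (x i : ℝ) ∂μ = n * r := by
    rw [integral_finsetSum _ fun i _ ↦ (hL i).integrable one_le_two]
    have (i : Fin n) : ∫ x, (x i : ℝ) ∂μ = r :=
      (integral_comp_eval (μ := fun _ : Fin n ↦ poissonMeasure r) (i := i)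
        (f := fun k : ℕ ↦ (k : ℝ)) .of_discrete).trans
        (integral_natCast_poissonMeasure r)
    simp [this]
  have hVS : Var[fun x : Fin n → ℕ ↦ ∑ i, (x i : ℝ); μ] = n * r := by
    have h := variance_sum_pi (fun _ : Fin n ↦ memLp_natCast_poissonMeasure r)
    simp only [variance_natCast_poissonMeasure, Finset.sum_const, Finset.card_univ,
      Fintype.card_fin, nsmul_eq_mul] at h
    rw [← h]
    congr 1
    ext x
    simp
  have hY : MemLp (fun x : Fin n → ℕ ↦ c * ∑ i, (x i : ℝ) + a) 2 μ :=
    (hS.const_mul c).add (memLp_const a)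
  have hEY : ∫ x, (c * ∑ i, (x i : ℝ) + a) ∂μ = c * (n * r) + a := by
    rw [integral_add ((hS.const_mul c).integrable one_le_two) (integrable_const a),
      integral_const_mul, hES]
    simp
  have h := variance_eq_sub hY
  rw [variance_add_const (hS.const_mul c).aestronglyMeasurable, variance_const_mul, hVS, hEY] at h
  simp only [Pi.pow_apply] at h
  linarith

end Poisson

section Gamma

lemma measurable_gammaPDF (a r : ℝ) : Measurable (gammaPDF a r) :=
  (measurable_gammaPDFReal a r).ennreal_ofReal

lemma ae_nonneg_gammaMeasure (a r : ℝ) : ∀ᵐ x ∂gammaMeasure a r, 0 ≤ x := by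
  rw [gammaMeasure, ae_withDensity_iff (measurable_gammaPDF a r)]
  refine .of_forall fun x hx ↦ ?_
  by_contra! h
  exact hx (gammaPDF_of_neg h)

lemma integrable_pow_gammaMeasure {a r : ℝ} (ha : 0 < a) (hr : 0 < r) (k : ℕ) :
    Integrable (fun x ↦ x ^ k) (gammaMeasure a r) := by
  rw [gammaMeasure, integrable_withDensity_iff (measurable_gammaPDF a r)
    (.of_forall fun _ ↦ ENNReal.ofReal_lt_top)]
  have h := (integrableOn_rpow_mul_exp_neg_mul_rpow (p := 1) (s := a - 1 + k) (b := r)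
    (by have := k.cast_nonneg (α := ℝ); linarith) one_pos hr).const_mul (r ^ a / Real.Gamma a)
  refine ((integrable_indicator_iff measurableSet_Ioi).2 h).congr ?_
  filter_upwards [Measure.ae_ne volume (0 : ℝ)] with x hx
  rw [gammaPDF, ENNReal.toReal_ofReal (gammaPDFReal_nonneg ha hr x), gammaPDFReal]
  rcases hx.lt_or_gt with hx | hx
  · simp [hx.le, hx.not_ge]
  · rw [Set.indicator_of_mem (Set.mem_Ioi.2 hx), if_pos hx.le, Real.rpow_add hx,
      Real.rpow_natCast, Real.rpow_one, neg_mul]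
    ring

end Gamma

/-- L² Bernstein–von Mises limit for the Poisson–gamma posterior variance under the prior:
`∫ (∫ |n·(α + S(x))/(n + β)² − θ|² dPoi(θ)^{⊗n}) dGamma(α,β)(θ) → 0` as `n → ∞`. -/
theorem poisson_gamma_bvm_L2_prior
    (α β : ℝ) (hα : 0 < α) (hβ : 0 < β) :
    Tendsto (fun n : ℕ =>
        ∫ θ : ℝ,
          (∫ x : Fin n → ℕ,
            |(n : ℝ) * ((α + ∑ i, (x i : ℝ)) / ((n : ℝ) + β) ^ 2) - θ| ^ 2
            ∂(Measure.pi fun _ : Fin n => poissonMeasure θ.toNNReal))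
          ∂(gammaMeasure α β))
      atTop (nhds 0) := by
  have := isProbabilityMeasure_gammaMeasure hα hβ
  set M₁ := ∫ θ, θ ^ 1 ∂gammaMeasure α β
  set M₂ := ∫ θ, θ ^ 2 ∂gammaMeasure α β
  set c : ℕ → ℝ := fun n ↦ n / (n + β) ^ 2 with hc
  have hinv : Tendsto (fun n : ℕ ↦ ((n : ℝ) + β)⁻¹) atTop (nhds 0) :=
    (tendsto_atTop_add_const_right _ β tendsto_natCast_atTop_atTop).inv_tendsto_atTop
  have hne (n : ℕ) : (n : ℝ) + β ≠ 0 := by positivity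
  have hratio : Tendsto (fun n : ℕ ↦ 1 - β * ((n : ℝ) + β)⁻¹) atTop (nhds 1) := by
    simpa using (hinv.const_mul β).const_sub 1
  have hc0 : Tendsto c atTop (nhds 0) := by
    rw [← one_mul (0 : ℝ)]
    refine (hratio.mul hinv).congr fun n ↦ ?_
    have := hne n
    simp only [hc]
    field_simp
    ring
  have hcn : Tendsto (fun n ↦ c n * n) atTop (nhds 1) := by
    rw [← one_pow (M := ℝ) 2]
    refine (hratio.pow 2).congr fun n ↦ ?_
    have := hne n
    simp only [hc]
    field_simp
    ring
  have key (n : ℕ) : ∫ θ : ℝ, (∫ x : Fin n → ℕ,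
      |(n : ℝ) * ((α + ∑ i, (x i : ℝ)) / ((n : ℝ) + β) ^ 2) - θ| ^ 2
        ∂(Measure.pi fun _ : Fin n => poissonMeasure θ.toNNReal)) ∂(gammaMeasure α β) =
      (c n * α) ^ 2 + (c n * (c n * n) + 2 * (c n * α) * (c n * n - 1)) * M₁
        + (c n * n - 1) ^ 2 * M₂ := by
    calc
      _ = ∫ θ : ℝ, ((c n * α) ^ 2 + (c n * (c n * n) + 2 * (c n * α) * (c n * n - 1)) * θ ^ 1
          + (c n * n - 1) ^ 2 * θ ^ 2) ∂(gammaMeasure α β) := by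
        refine integral_congr_ae ?_
        filter_upwards [ae_nonneg_gammaMeasure α β] with θ hθ
        have h := integral_sq_affine_sum_pi_poissonMeasure n θ.toNNReal (c n * α - θ) (c n)
        rw [Real.coe_toNNReal θ hθ] at h
        trans c n ^ 2 * (n * θ) + (c n * (n * θ) + (c n * α - θ)) ^ 2
        · rw [← h]
          congr 1
          ext x
          rw [sq_abs]
          simp only [hc]
          ring
        · ring
      _ = _ := by
        have h₁ := (integrable_pow_gammaMeasure hα hβ 1).const_mul
          (c n * (c n * n) + 2 * (c n * α) * (c n * n - 1))
        have h₂ := (integrable_pow_gammaMeasure hα hβ 2).const_mul ((c n * n - 1) ^ 2)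
        have h₀ := integrable_const (μ := gammaMeasure α β) ((c n * α) ^ 2)
        rw [integral_add (by exact h₀.add h₁) h₂, integral_add h₀ h₁,
          integral_const_mul, integral_const_mul]
        simp [M₁, M₂]
  simp_rw [key]
  have hlim := (((hc0.mul_const α).pow 2).add
    (((hc0.mul hcn).add (((hc0.mul_const α).const_mul 2).mul (hcn.sub_const 1))).mul_const M₁)).add
    (((hcn.sub_const 1).pow 2).mul_const M₂)
  simpa using hlim
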